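/- Fix T > 0 and integers d ≥ k ≥ 1. Let C([0,T], ℝ^d) denote the space of continuous functions from [0,T] to ℝ^d with the uniform topology and its Borel σ-algebra, and let σ : [0,T] × C([0,T], ℝ^d) → ℝ^{d×k} be Borel measurable. Then there exists a Borel-measurable map τ : [0,T] × C([0,T], ℝ^d) → ℝ^{k×d} such that τ(t,x)·σ(t,x) = I_{k×k} for every (t,x) ∈ [0,T] × C([0,T], ℝ^d) at which rank(σ(t,x)) = k, where I_{k×k} is the k×k identity matrix. -/

import Mathlib

open MeasureTheory
open scoped Matrix

/-- The space of continuous maps carries the Borel σ-algebra of the compact-open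
(uniform, for compact domain) topology. -/
instance contMapMeasurableSpace {X Y : Type*} [TopologicalSpace X] [TopologicalSpace Y] :
    MeasurableSpace C(X, Y) := borel _

/-- Matrices carry the (Borel) product σ-algebra, entrywise. -/
instance matrixMeasurableSpace {m n : Type*} {α : Type*} [MeasurableSpace α] :
    MeasurableSpace (Matrix m n α) := inferInstanceAs (MeasurableSpace (m → n → α))

theorem measurable_matrix_iff {Ω m n α : Type*} [MeasurableSpace Ω] [MeasurableSpace α]
    {f : Ω → Matrix m n α} : Measurable f ↔ ∀ i j, Measurable fun ω => f ω i j := by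
  refine Iff.trans (measurable_pi_iff (X := fun _ : m => n → α)) ?_
  exact forall_congr' fun i => measurable_pi_iff

theorem Measurable.matrix_transpose {Ω m n α : Type*} [MeasurableSpace Ω] [MeasurableSpace α]
    {f : Ω → Matrix m n α} (hf : Measurable f) : Measurable fun ω => (f ω)ᵀ :=
  measurable_matrix_iff.2 fun i j => measurable_matrix_iff.1 hf j i

theorem Measurable.matrix_mul {Ω l m n : Type*} [MeasurableSpace Ω] [Fintype m]
    {f : Ω → Matrix l m ℝ} {g : Ω → Matrix m n ℝ} (hf : Measurable f) (hg : Measurable g) :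
    Measurable fun ω => f ω * g ω := by
  rw [measurable_matrix_iff] at *
  intro i j
  simp only [Matrix.mul_apply]
  exact Finset.measurable_sum _ fun a _ => (hf i a).mul (hg a j)

theorem Measurable.matrix_det {Ω n : Type*} [MeasurableSpace Ω] [Fintype n] [DecidableEq n]
    {f : Ω → Matrix n n ℝ} (hf : Measurable f) : Measurable fun ω => (f ω).det := by
  rw [measurable_matrix_iff] at hf
  simp only [Matrix.det_apply']
  exact Finset.measurable_sum _ fun s _ =>
    (Finset.measurable_prod _ fun i _ => hf (s i) i).const_mul _

theorem Measurable.matrix_inv {Ω n : Type*} [MeasurableSpace Ω] [Fintype n] [DecidableEq n]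
    {f : Ω → Matrix n n ℝ} (hf : Measurable f) : Measurable fun ω => (f ω)⁻¹ := by
  rw [measurable_matrix_iff]
  intro i j
  simp only [Matrix.inv_def, Ring.inverse_eq_inv', Matrix.smul_apply, smul_eq_mul,
    Matrix.adjugate_apply]
  refine hf.matrix_det.inv.mul (Measurable.matrix_det ?_)
  rw [measurable_matrix_iff] at *
  intro a b
  by_cases h : a = j
  · subst h
    simp
  · simpa [Matrix.updateRow_ne h] using hf a b

/-- The Gram matrix of a real matrix of full column rank is invertible. -/
theorem isUnit_transpose_mul_self_of_rank_eq {m n : Type*} [Fintype m] [Fintype n]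
    [DecidableEq n] {A : Matrix m n ℝ} (hA : A.rank = Fintype.card n) : IsUnit (Aᵀ * A) := by
  rw [← Matrix.mulVec_surjective_iff_isUnit, ← Matrix.coe_mulVecLin, ← LinearMap.range_eq_top]
  apply Submodule.eq_top_of_finrank_eq
  rw [← Matrix.rank, Matrix.rank_transpose_mul_self, hA, Module.finrank_fintype_fun_eq_card]

/-- Fix `T > 0` and `d ≥ k ≥ 1`.  For every Borel-measurable
`σ : [0,T] × C([0,T], ℝ^d) → ℝ^{d×k}` there exists a Borel-measurable
`τ : [0,T] × C([0,T], ℝ^d) → ℝ^{k×d}` such that `τ(t,x) · σ(t,x) = I_{k×k}` at every point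
`(t,x)` at which `rank(σ(t,x)) = k`. -/
theorem stmt4 (T : ℝ) (hT : 0 < T) (d k : ℕ) (hk : 1 ≤ k) (hkd : k ≤ d)
    (σ : Set.Icc (0 : ℝ) T × C(Set.Icc (0 : ℝ) T, EuclideanSpace ℝ (Fin d)) →
      Matrix (Fin d) (Fin k) ℝ)
    (hmeas : Measurable σ) :
    ∃ τ : Set.Icc (0 : ℝ) T × C(Set.Icc (0 : ℝ) T, EuclideanSpace ℝ (Fin d)) →
        Matrix (Fin k) (Fin d) ℝ,
      Measurable τ ∧ ∀ p, (σ p).rank = k → τ p * σ p = (1 : Matrix (Fin k) (Fin k) ℝ) := by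
  refine ⟨fun p => ((σ p)ᵀ * σ p)⁻¹ * (σ p)ᵀ,
    (hmeas.matrix_transpose.matrix_mul hmeas).matrix_inv.matrix_mul hmeas.matrix_transpose,
    fun p hp => ?_⟩
  have h : IsUnit ((σ p)ᵀ * σ p) := isUnit_transpose_mul_self_of_rank_eq (by simpa using hp)
  rw [Matrix.mul_assoc, Matrix.nonsing_inv_mul _ ((Matrix.isUnit_iff_isUnit_det _).1 h)]
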